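/- For every two-player LTL game G (|Ag| = 2), the strong core SC(G) is nonempty. -/

import Mathlib

/-- A concurrent game structure over a set of agents `Ag`, states `St`, and,
for each agent `i`, a set of actions `Ac i`.  It consists of an initial state
and a transition function. -/
structure CGS (Ag St : Type) (Ac : Ag → Type) where
  init : St
  tr : St → (∀ i, Ac i) → St

/-- A strategy for a player with actions `A`: it maps finite (nonempty)
histories of states, given as lists, to an action. -/
abbrev Strategy (St A : Type) := List St → A

/-- A strategy profile: one strategy for each player. -/
abbrev Profile {Ag : Type} (St : Type) (Ac : Ag → Type) := ∀ i, Strategy St (Ac i)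

namespace CGS

variable {Ag St : Type} {Ac : Ag → Type}

/-- The history `ρ(σ)[0 … t]` (as a list) together with the current state
`ρ(σ)[t]` of the run induced by a strategy profile `σ`. -/
def histRun (M : CGS Ag St Ac) (σ : Profile St Ac) : ℕ → List St × St
  | 0 => ([M.init], M.init)
  | t + 1 =>
      let p := histRun M σ t
      let s := M.tr p.2 (fun i => σ i p.1)
      (p.1 ++ [s], s)

/-- The unique run `ρ(σ)` induced by a strategy profile `σ`. -/
def run (M : CGS Ag St Ac) (σ : Profile St Ac) (t : ℕ) : St :=
  (histRun M σ t).2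

/-- A run of `M`: an infinite state sequence starting at the initial state in
which every step is obtained by some action profile. -/
def IsRun (M : CGS Ag St Ac) (ρ : ℕ → St) : Prop :=
  ρ 0 = M.init ∧ ∀ t, ∃ a : ∀ i, Ac i, ρ (t + 1) = M.tr (ρ t) a

end CGS

open Classical in
/-- Combine a joint strategy `σC` for a coalition `C` with strategies `σN`
for the players outside `C`, obtaining a full strategy profile. -/
noncomputable def combine {Ag St : Type} {Ac : Ag → Type} (C : Set Ag)
    (σC : ∀ i ∈ C, Strategy St (Ac i)) (σN : ∀ i ∉ C, Strategy St (Ac i)) :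
    Profile St Ac :=
  fun i => if h : i ∈ C then σC i h else σN i h

/-- Syntax of Linear Temporal Logic over atomic propositions `AP`:
atoms, negation, disjunction, next, and until. -/
inductive LTLFormula (AP : Type) where
  | atom : AP → LTLFormula AP
  | neg  : LTLFormula AP → LTLFormula AP
  | disj : LTLFormula AP → LTLFormula AP → LTLFormula AP
  | next : LTLFormula AP → LTLFormula AP
  | untl : LTLFormula AP → LTLFormula AP → LTLFormula AP

/-- Standard LTL semantics over infinite runs `ρ : ℕ → St`, via a labelling
function `lab : St → Set AP`. -/
def LTLFormula.Sat {AP St : Type} (lab : St → Set AP) :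
    LTLFormula AP → (ℕ → St) → Prop
  | .atom p, ρ => p ∈ lab (ρ 0)
  | .neg φ, ρ => ¬ LTLFormula.Sat lab φ ρ
  | .disj φ ψ, ρ => LTLFormula.Sat lab φ ρ ∨ LTLFormula.Sat lab ψ ρ
  | .next φ, ρ => LTLFormula.Sat lab φ (fun t => ρ (t + 1))
  | .untl φ ψ, ρ =>
      ∃ j : ℕ, LTLFormula.Sat lab ψ (fun t => ρ (t + j)) ∧
        ∀ k < j, LTLFormula.Sat lab φ (fun t => ρ (t + k))

/-- An LTL game: a concurrent game structure together with a labelling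
function and an LTL goal for each player. -/
structure LTLGame (Ag St : Type) (Ac : Ag → Type) (AP : Type) where
  M : CGS Ag St Ac
  lab : St → Set AP
  goal : Ag → LTLFormula AP

namespace LTLGame

variable {Ag St AP : Type} {Ac : Ag → Type}

/-- The winners of a run: players whose goal is satisfied by the run. -/
def winners (G : LTLGame Ag St Ac AP) (ρ : ℕ → St) : Set Ag :=
  {i | (G.goal i).Sat G.lab ρ}

/-- `σC` is a beneficial deviation for the (nonempty) coalition `C` from the
strategy profile `σ`: every member of `C` loses under `σ`, and all members of
`C` win under `(σC, σN)` no matter which joint strategy `σN` the remaining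
players use. -/
def BeneficialDeviation (G : LTLGame Ag St Ac AP) (C : Set Ag)
    (σ : Profile St Ac) (σC : ∀ i ∈ C, Strategy St (Ac i)) : Prop :=
  C.Nonempty ∧
  C ⊆ (G.winners (G.M.run σ))ᶜ ∧
  ∀ σN : ∀ i ∉ C, Strategy St (Ac i), C ⊆ G.winners (G.M.run (combine C σC σN))

/-- A strategy profile is in the core iff no coalition has a beneficial
deviation from it. -/
def inCore (G : LTLGame Ag St Ac AP) (σ : Profile St Ac) : Prop :=
  ∀ (C : Set Ag) (σC : ∀ i ∈ C, Strategy St (Ac i)),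
    ¬ G.BeneficialDeviation C σ σC

/-- A (nonempty) coalition `C` is fulfilled if it has a joint strategy
guaranteeing all goals of its members, against every joint strategy of the
remaining players. -/
def Fulfilled (G : LTLGame Ag St Ac AP) (C : Set Ag) : Prop :=
  C.Nonempty ∧
  ∃ σC : ∀ i ∈ C, Strategy St (Ac i),
    ∀ σN : ∀ i ∉ C, Strategy St (Ac i),
      C ⊆ G.winners (G.M.run (combine C σC σN))

/-- `σC` is a strong beneficial deviation for the (nonempty) coalition `C`
from `σ`: (1) all members of `C` lose under `σ`; (2) all members of `C` win
under `(σ₋C, σC)`; (3) against every counter joint strategy `σN` under which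
all original winners still win, all members of `C` win. -/
def StrongBeneficialDeviation (G : LTLGame Ag St Ac AP) (C : Set Ag)
    (σ : Profile St Ac) (σC : ∀ i ∈ C, Strategy St (Ac i)) : Prop :=
  C.Nonempty ∧
  C ⊆ (G.winners (G.M.run σ))ᶜ ∧
  C ⊆ G.winners (G.M.run (combine C σC (fun i _ => σ i))) ∧
  ∀ σN : ∀ i ∉ C, Strategy St (Ac i),
    G.winners (G.M.run σ) ⊆ G.winners (G.M.run (combine C σC σN)) →
      C ⊆ G.winners (G.M.run (combine C σC σN))

/-- A strategy profile is in the strong core iff no coalition has a strong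
beneficial deviation from it. -/
def inStrongCore (G : LTLGame Ag St Ac AP) (σ : Profile St Ac) : Prop :=
  ∀ (C : Set Ag) (σC : ∀ i ∈ C, Strategy St (Ac i)),
    ¬ G.StrongBeneficialDeviation C σ σC

/-- `(G, φ) ∈ E-Core` iff some member of the core of `G` induces a run
satisfying `φ`. -/
def ECore (G : LTLGame Ag St Ac AP) (φ : LTLFormula AP) : Prop :=
  ∃ σ : Profile St Ac, G.inCore σ ∧ φ.Sat G.lab (G.M.run σ)

end LTLGame

theorem combine_eq_of_agree {Ag St : Type} {Ac : Ag → Type} {C : Set Ag}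
    {σC : ∀ i ∈ C, Strategy St (Ac i)} {τ : Profile St Ac}
    (h : ∀ i (hi : i ∈ C), τ i = σC i hi) :
    combine C σC (fun i _ => τ i) = τ := by
  funext i
  by_cases hi : i ∈ C <;> simp [combine, hi, h]

theorem combine_apply_of_notMem {Ag St : Type} {Ac : Ag → Type} {C : Set Ag}
    (σC : ∀ i ∈ C, Strategy St (Ac i)) (σN : ∀ i ∉ C, Strategy St (Ac i)) {i : Ag}
    (hi : i ∉ C) : combine C σC σN i = σN i hi := by
  simp [combine, hi]

namespace LTLGame

variable {Ag St AP : Type} {Ac : Ag → Type}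

theorem inStrongCore_of_winners_eq_univ {G : LTLGame Ag St Ac AP} {σ : Profile St Ac}
    (h : G.winners (G.M.run σ) = Set.univ) : G.inStrongCore σ := by
  rintro C σC ⟨⟨j, hj⟩, hlose, -⟩
  exact hlose hj (h ▸ Set.mem_univ j)

/-- With two players who never win together, a deviating coalition is a singleton. -/
theorem StrongBeneficialDeviation.exists_singleton {G : LTLGame Ag St Ac AP}
    (htwo : ∀ i j k : Ag, i ≠ j → k = i ∨ k = j)
    (hboth : ∀ σ, G.winners (G.M.run σ) ≠ Set.univ)
    {C : Set Ag} {σ : Profile St Ac} {σC : ∀ i ∈ C, Strategy St (Ac i)}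
    (h : G.StrongBeneficialDeviation C σ σC) :
    ∃ i j, i ≠ j ∧ C = {j} := by
  obtain ⟨⟨j, hj⟩, -, hwin, -⟩ := h
  obtain ⟨i, hi⟩ : ∃ i, i ∉ C :=
    (Set.ne_univ_iff_exists_notMem C).1 fun hC =>
      hboth _ (Set.univ_subset_iff.1 (hC.symm.subset.trans hwin))
  have hij : i ≠ j := fun e => hi (e ▸ hj)
  refine ⟨i, j, hij, Set.eq_singleton_iff_unique_mem.2 ⟨hj, fun k hk => ?_⟩⟩
  exact (htwo i j k hij).resolve_left fun e => hi (e ▸ hk)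

/-- If player `i` wins whenever it plays `σ i` and the two players never win together,
then `σ` is in the strong core. -/
theorem inStrongCore_of_forall_mem_winners {G : LTLGame Ag St Ac AP}
    (htwo : ∀ i j k : Ag, i ≠ j → k = i ∨ k = j)
    (hboth : ∀ σ, G.winners (G.M.run σ) ≠ Set.univ) {σ : Profile St Ac} {i : Ag}
    (hi : ∀ τ : Profile St Ac, τ i = σ i → i ∈ G.winners (G.M.run τ)) :
    G.inStrongCore σ := by
  intro C σC h
  obtain ⟨_, j, -, rfl⟩ := h.exists_singleton htwo hboth
  obtain ⟨-, hlose, hwin, -⟩ := h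
  have hiC : i ∉ ({j} : Set Ag) := fun hiC => hlose hiC (hi σ rfl)
  refine hboth (combine {j} σC fun i _ => σ i) (Set.eq_univ_of_forall fun k => ?_)
  rcases htwo i j k hiC with rfl | rfl
  · exact hi _ (combine_apply_of_notMem _ _ hiC)
  · exact hwin rfl

/-- If the two players never win together and none of them has a winning strategy, then `σ` is in
the strong core as soon as it has no winners, or every profile has a winner. -/
theorem inStrongCore_of_forall_exists_notMem_winners {G : LTLGame Ag St Ac AP}
    (htwo : ∀ i j k : Ag, i ≠ j → k = i ∨ k = j)
    (hboth : ∀ σ, G.winners (G.M.run σ) ≠ Set.univ)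
    (hnone : ∀ (i : Ag) (σ : Profile St Ac),
      ∃ τ : Profile St Ac, τ i = σ i ∧ i ∉ G.winners (G.M.run τ))
    {σ : Profile St Ac}
    (hσ : G.winners (G.M.run σ) = ∅ ∨ ∀ τ, (G.winners (G.M.run τ)).Nonempty) :
    G.inStrongCore σ := by
  intro C σC h
  obtain ⟨i, j, hij, rfl⟩ := h.exists_singleton htwo hboth
  obtain ⟨-, hlose, -, hall⟩ := h
  obtain ⟨τ, hτ, hjτ⟩ := hnone j (combine {j} σC fun i _ => σ i)
  have heq : combine {j} σC (fun i _ => τ i) = τ := by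
    refine combine_eq_of_agree ?_
    rintro k rfl
    simp [hτ, combine]
  have hsub : G.winners (G.M.run σ) ⊆ G.winners (G.M.run τ) := by
    rcases hσ with hσ | hσ
    · simp [hσ]
    · intro k hk
      obtain ⟨w, hw⟩ := hσ τ
      obtain rfl : w = i := (htwo i j w hij).resolve_right fun e => hjτ (e ▸ hw)
      obtain rfl : k = w := (htwo w j k hij).resolve_right fun e => hlose e hk
      exact hw
  have := hall (fun i _ => τ i)
  rw [heq] at this
  exact hjτ (this hsub rfl)

end LTLGame

/-- For every two-player LTL game `G` (`|Ag| = 2`), the strong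
core `SC(G)` is nonempty. -/
theorem strongCore_nonempty_of_two_players
    {Ag St AP : Type} {Ac : Ag → Type}
    [Fintype Ag] [Fintype St]
    [∀ i, Fintype (Ac i)] [∀ i, Nonempty (Ac i)] [Fintype AP]
    (hcard : Fintype.card Ag = 2)
    (G : LTLGame Ag St Ac AP) :
    ∃ σ : Profile St Ac, G.inStrongCore σ := by
  have htwo : ∀ i j k : Ag, i ≠ j → k = i ∨ k = j := by
    intro i j k hij
    by_contra! hk
    have := Fintype.two_lt_card_iff.2 ⟨i, j, k, hij, hk.1.symm, hk.2.symm⟩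
    omega
  by_cases hboth : ∃ σ, G.winners (G.M.run σ) = Set.univ
  · obtain ⟨σ, hσ⟩ := hboth
    exact ⟨σ, LTLGame.inStrongCore_of_winners_eq_univ hσ⟩
  push Not at hboth
  by_cases hwin : ∃ (i : Ag) (σ : Profile St Ac),
      ∀ τ : Profile St Ac, τ i = σ i → i ∈ G.winners (G.M.run τ)
  · obtain ⟨i, σ, hσ⟩ := hwin
    exact ⟨σ, LTLGame.inStrongCore_of_forall_mem_winners htwo hboth hσ⟩
  push Not at hwin
  by_cases hempty : ∃ σ, G.winners (G.M.run σ) = ∅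
  · obtain ⟨σ, hσ⟩ := hempty
    exact ⟨σ, LTLGame.inStrongCore_of_forall_exists_notMem_winners htwo hboth hwin (.inl hσ)⟩
  · push Not at hempty
    exact ⟨fun _ _ => Classical.arbitrary _,
      LTLGame.inStrongCore_of_forall_exists_notMem_winners htwo hboth hwin (.inr hempty)⟩
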